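/- arXiv:2511.10181 — 2 statements merged into one kernel-verified Lean document; each statement's English description precedes it below -/
import Mathlib

section
/- (Theorem 3) For the sequential adversarial hypothesis testing problem under the constraint that both the worst-case type-I and type-II error probabilities are at most β, the closure of the set of achievable pairs of exponents is exactly 𝓔̃(𝒫,𝒬) = {(Ẽ₀,Ẽ₁) : Ẽ₀ ≤ D(p₀*‖q₀*) and Ẽ₁ ≤ D(q₁*‖p₁*)}; in particular, the corner point (D(p₀*‖q₀*), D(q₁*‖p₁*)) is achievable. -/
open scoped BigOperators ENNReal

variable {𝒳 : Type*}

/-- A probability mass function on the finite alphabet `𝒳`. -/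
def IsDist [Fintype 𝒳] (f : 𝒳 → ℝ) : Prop :=
  (∀ x, 0 ≤ f x) ∧ ∑ x, f x = 1

/-- Kullback–Leibler divergence `D(p‖q) = ∑ₓ p(x) log (p(x)/q(x))`. -/
noncomputable def KL [Fintype 𝒳] (p q : 𝒳 → ℝ) : ℝ :=
  ∑ x, p x * Real.log (p x / q x)

/-- Probability of observing the finite sequence `l` under the adaptive strategy `str`:
`ℙ(x^t) = ∏ᵢ str(x^{i-1})(xᵢ)`. -/
noncomputable def seqProb [Fintype 𝒳] (str : List 𝒳 → 𝒳 → ℝ) (l : List 𝒳) : ℝ :=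
  ∏ i : Fin l.length, str (l.take i.1) (l.get i)

/-- Log-likelihood-ratio sum `S_t = ∑ᵢ log (p(xᵢ)/q(xᵢ))`. -/
noncomputable def llSum (p q : 𝒳 → ℝ) (l : List 𝒳) : ℝ :=
  ∑ i : Fin l.length, Real.log (p (l.get i) / q (l.get i))

/-- An adaptive adversary strategy choosing, after each history, a distribution in `P`. -/
def IsStrategy (P : Set (𝒳 → ℝ)) (str : List 𝒳 → 𝒳 → ℝ) : Prop :=
  ∀ l, str l ∈ P

open Classical in
/-- Probability that the first `n` observations form a sequence satisfying `E`. -/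
noncomputable def probAt [Fintype 𝒳] (str : List 𝒳 → 𝒳 → ℝ) (n : ℕ)
    (E : List 𝒳 → Prop) : ℝ :=
  ∑ x : Fin n → 𝒳, if E (List.ofFn x) then seqProb str (List.ofFn x) else 0

/-- No prefix of `l` (including `l` itself) lies in the stopping region `B`;
for `l` of length `n` this is the event `{τ_B > n}`. -/
def notYet (B : List 𝒳 → Prop) (l : List 𝒳) : Prop :=
  ∀ t ≤ l.length, ¬ B (l.take t)

/-- `l` is a stopped sequence of the first-hitting time `τ_B` of the region `B`. -/
def stopsAt (B : List 𝒳 → Prop) (l : List 𝒳) : Prop :=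
  B l ∧ ∀ t < l.length, ¬ B (l.take t)

/-- Expected stopping time `E[τ_B] = ∑_{n ≥ 0} ℙ(τ_B > n)`, valued in `ℝ≥0∞`. -/
noncomputable def expTau [Fintype 𝒳] (str : List 𝒳 → 𝒳 → ℝ) (B : List 𝒳 → Prop) : ℝ≥0∞ :=
  ∑' n : ℕ, ENNReal.ofReal (probAt str n (notYet B))

open Classical in
/-- Expectation of `f` evaluated at the stopped sequence `X^{τ_B}`. -/
noncomputable def expStopped [Fintype 𝒳] (str : List 𝒳 → 𝒳 → ℝ) (B : List 𝒳 → Prop)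
    (f : List 𝒳 → ℝ) : ℝ :=
  ∑' l : List 𝒳, if stopsAt B l then seqProb str l * f l else 0

open Classical in
/-- Probability that the process stops (via `B`) at a sequence satisfying `E`. -/
noncomputable def probStopIn [Fintype 𝒳] (str : List 𝒳 → 𝒳 → ℝ) (B : List 𝒳 → Prop)
    (E : List 𝒳 → Prop) : ℝ :=
  ∑' l : List 𝒳, if stopsAt B l ∧ E l then seqProb str l else 0

open Classical in
/-- Probability, under the law induced by strategy `str`, that the test with stopping
region `B` and decision rule `Z` stops and outputs the decision `b`
(`b = true` codes the decision `1`, `b = false` the decision `0`). -/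
noncomputable def errProb [Fintype 𝒳] (str : List 𝒳 → 𝒳 → ℝ) (B : List 𝒳 → Prop)
    (Z : List 𝒳 → Bool) (b : Bool) : ℝ :=
  ∑' l : List 𝒳, if stopsAt B l ∧ Z l = b then seqProb str l else 0

/-- Worst-case (over adaptive adversary strategies with values in `P`) probability of
outputting the decision `b`. -/
noncomputable def worstErr [Fintype 𝒳] (P : Set (𝒳 → ℝ)) (B : List 𝒳 → Prop)
    (Z : List 𝒳 → Bool) (b : Bool) : ℝ :=
  ⨆ str : {s : List 𝒳 → 𝒳 → ℝ // IsStrategy P s}, errProb str.1 B Z b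

/-- Worst-case (over adaptive adversary strategies with values in `P`) expected
stopping time. -/
noncomputable def worstExpTau [Fintype 𝒳] (P : Set (𝒳 → ℝ)) (B : List 𝒳 → Prop) : ℝ≥0∞ :=
  ⨆ str : {s : List 𝒳 → 𝒳 → ℝ // IsStrategy P s}, expTau str.1 B

/-- A pair of exponents `(Ẽ₀, Ẽ₁)` is achievable for the sequential adversarial hypothesis
testing problem under the constraint on the probability of error: there is a family of
tests `φ_β = (τ_β, Z_β)` for `β > 0` with worst-case type-I and type-II error probabilities
at most `β`, such that `Ẽ₀ ≤ liminf_{β→0} inf_𝒜 (−log β)/E_ℙ[τ_β]` and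
`Ẽ₁ ≤ liminf_{β→0} inf_𝒜 (−log β)/E_ℚ[τ_β]`. -/
def AchievableTilde [Fintype 𝒳] (P Q : Set (𝒳 → ℝ)) (E₀ E₁ : ℝ) : Prop :=
  ∃ (B : ℝ → List 𝒳 → Prop) (Z : ℝ → List 𝒳 → Bool),
    (∀ β : ℝ, 0 < β →
      (∀ str : List 𝒳 → 𝒳 → ℝ, IsStrategy P str → errProb str (B β) (Z β) true ≤ β) ∧
      (∀ str : List 𝒳 → 𝒳 → ℝ, IsStrategy Q str → errProb str (B β) (Z β) false ≤ β)) ∧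
    E₀ ≤ Filter.liminf
      (fun β : ℝ => ⨅ str : {s : List 𝒳 → 𝒳 → ℝ // IsStrategy P s},
        -Real.log β / (expTau str.1 (B β)).toReal)
      (nhdsWithin 0 (Set.Ioi 0)) ∧
    E₁ ≤ Filter.liminf
      (fun β : ℝ => ⨅ str : {s : List 𝒳 → 𝒳 → ℝ // IsStrategy Q s},
        -Real.log β / (expTau str.1 (B β)).toReal)
      (nhdsWithin 0 (Set.Ioi 0))

theorem seqProb_nil [Fintype 𝒳] (str : List 𝒳 → 𝒳 → ℝ) : seqProb str [] = 1 := by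
  simp [seqProb]

theorem seqProb_append_singleton [Fintype 𝒳] (str : List 𝒳 → 𝒳 → ℝ) (l : List 𝒳) (y : 𝒳) :
    seqProb str (l ++ [y]) = seqProb str l * str l y := by
  have h : l.length + 1 = (l ++ [y]).length := by simp
  unfold seqProb
  rw [← Equiv.prod_comp (finCongr h), Fin.prod_univ_castSucc]
  congr 1
  · refine Finset.prod_congr rfl fun i _ => ?_
    simp [List.take_append_of_le_length i.2.le]
  · simp

theorem llSum_nil (p q : 𝒳 → ℝ) : llSum p q [] = 0 := by
  simp [llSum]

theorem llSum_append_singleton (p q : 𝒳 → ℝ) (l : List 𝒳) (y : 𝒳) :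
    llSum p q (l ++ [y]) = llSum p q l + Real.log (p y / q y) := by
  have h : l.length + 1 = (l ++ [y]).length := by simp
  unfold llSum
  rw [← Equiv.sum_comp (finCongr h), Fin.sum_univ_castSucc]
  congr 1
  · refine Finset.sum_congr rfl fun i _ => ?_
    simp
  · simp

theorem seqProb_nonneg [Fintype 𝒳] {str : List 𝒳 → 𝒳 → ℝ} (hs : ∀ l, IsDist (str l)) (l : List 𝒳) :
    0 ≤ seqProb str l :=
  Finset.prod_nonneg fun _ _ => (hs _).1 _

/-- Expectation of a function of the first `n` observations. -/
noncomputable def horizonExp [Fintype 𝒳] (str : List 𝒳 → 𝒳 → ℝ) (n : ℕ) (F : List 𝒳 → ℝ) : ℝ :=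
  ∑ x : Fin n → 𝒳, seqProb str (List.ofFn x) * F (List.ofFn x)

theorem horizonExp_zero [Fintype 𝒳] (str : List 𝒳 → 𝒳 → ℝ) (F : List 𝒳 → ℝ) :
    horizonExp str 0 F = F [] := by
  simp [horizonExp, seqProb_nil]

theorem horizonExp_succ [Fintype 𝒳] (str : List 𝒳 → 𝒳 → ℝ) (n : ℕ) (F : List 𝒳 → ℝ) :
    horizonExp str (n + 1) F = horizonExp str n fun l => ∑ y, str l y * F (l ++ [y]) := by
  unfold horizonExp
  rw [← Equiv.sum_comp (Fin.snocEquiv fun _ : Fin (n + 1) => 𝒳), Fintype.sum_prod_type_right]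
  refine Finset.sum_congr rfl fun x _ => ?_
  rw [Finset.mul_sum]
  refine Finset.sum_congr rfl fun y _ => ?_
  have h : List.ofFn (Fin.snoc (α := fun _ => 𝒳) x y) = List.ofFn x ++ [y] := by
    rw [List.ofFn_succ', List.concat_eq_append]
    simp
  change seqProb str (List.ofFn (Fin.snoc (α := fun _ => 𝒳) x y)) *
    F (List.ofFn (Fin.snoc (α := fun _ => 𝒳) x y)) = _
  rw [h, seqProb_append_singleton, mul_assoc]

theorem horizonExp_mono [Fintype 𝒳] {str : List 𝒳 → 𝒳 → ℝ} (hs : ∀ l, IsDist (str l)) (n : ℕ)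
    {F G : List 𝒳 → ℝ} (h : ∀ l, F l ≤ G l) : horizonExp str n F ≤ horizonExp str n G :=
  Finset.sum_le_sum fun _ _ => mul_le_mul_of_nonneg_left (h _) (seqProb_nonneg hs _)

theorem horizonExp_nonneg [Fintype 𝒳] {str : List 𝒳 → 𝒳 → ℝ} (hs : ∀ l, IsDist (str l)) (n : ℕ)
    {F : List 𝒳 → ℝ} (h : ∀ l, 0 ≤ F l) : 0 ≤ horizonExp str n F :=
  Finset.sum_nonneg fun _ _ => mul_nonneg (seqProb_nonneg hs _) (h _)

theorem horizonExp_add [Fintype 𝒳] (str : List 𝒳 → 𝒳 → ℝ) (n : ℕ) (F G : List 𝒳 → ℝ) :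
    horizonExp str n (fun l => F l + G l) = horizonExp str n F + horizonExp str n G := by
  simp [horizonExp, mul_add, Finset.sum_add_distrib]

theorem horizonExp_const_mul [Fintype 𝒳] (str : List 𝒳 → 𝒳 → ℝ) (n : ℕ) (c : ℝ) (F : List 𝒳 → ℝ) :
    horizonExp str n (fun l => c * F l) = c * horizonExp str n F := by
  simp only [horizonExp, Finset.mul_sum]
  exact Finset.sum_congr rfl fun _ _ => by ring

open Classical in
theorem probAt_eq_horizonExp [Fintype 𝒳] (str : List 𝒳 → 𝒳 → ℝ) (n : ℕ) (E : List 𝒳 → Prop) :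
    probAt str n E = horizonExp str n fun l => if E l then 1 else 0 := by
  simp [probAt, horizonExp]

theorem probAt_nonneg [Fintype 𝒳] {str : List 𝒳 → 𝒳 → ℝ} (hs : ∀ l, IsDist (str l)) (n : ℕ)
    (E : List 𝒳 → Prop) : 0 ≤ probAt str n E := by
  classical
  rw [probAt_eq_horizonExp]
  exact horizonExp_nonneg hs n fun l => by split_ifs <;> norm_num

theorem not_notYet_of_stopsAt {B : List 𝒳 → Prop} {l : List 𝒳} (h : stopsAt B l) :
    ¬ notYet B l := fun h' => h' l.length le_rfl (by simpa using h.1)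

theorem stopsAt_or_notYet_append (B : List 𝒳 → Prop) (l : List 𝒳) (y : 𝒳) :
    stopsAt B (l ++ [y]) ∨ notYet B (l ++ [y]) ↔ notYet B l := by
  have key : ∀ t ≤ l.length, (l ++ [y]).take t = l.take t := fun t ht =>
    List.take_append_of_le_length ht
  constructor
  · rintro (h | h) t ht
    · have := h.2 t (by simp; omega)
      rwa [key t ht] at this
    · have := h t (by simp; omega)
      rwa [key t ht] at this
  · intro h
    by_cases hB : B (l ++ [y])
    · refine Or.inl ⟨hB, fun t ht => ?_⟩
      have ht' : t ≤ l.length := by simp at ht; omega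
      rw [key t ht']
      exact h t ht'
    · refine Or.inr fun t ht => ?_
      rcases Nat.lt_or_ge l.length t with h1 | h1
      · rwa [List.take_of_length_le (by simp; omega)]
      · rw [key t h1]
        exact h t h1

open Classical in
/-- Expectation of `F` evaluated at the sequence observed up to time `τ_B ∧ n`. -/
noncomputable def stoppedExp [Fintype 𝒳] (str : List 𝒳 → 𝒳 → ℝ) (B : List 𝒳 → Prop) (n : ℕ)
    (F : List 𝒳 → ℝ) : ℝ :=
  ∑ k ∈ Finset.range (n + 1), horizonExp str k (fun l => if stopsAt B l then F l else 0) +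
    horizonExp str n fun l => if notYet B l then F l else 0

theorem stoppedExp_mono [Fintype 𝒳] {str : List 𝒳 → 𝒳 → ℝ} (hs : ∀ l, IsDist (str l))
    (B : List 𝒳 → Prop) (n : ℕ) {F G : List 𝒳 → ℝ}
    (h : ∀ l, stopsAt B l ∨ notYet B l → F l ≤ G l) :
    stoppedExp str B n F ≤ stoppedExp str B n G := by
  classical
  refine add_le_add (Finset.sum_le_sum fun k _ => ?_) ?_
  · refine horizonExp_mono hs k fun l => ?_
    split_ifs with hl
    exacts [h l (Or.inl hl), le_rfl]
  · refine horizonExp_mono hs n fun l => ?_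
    split_ifs with hl
    exacts [h l (Or.inr hl), le_rfl]

theorem stoppedExp_add [Fintype 𝒳] (str : List 𝒳 → 𝒳 → ℝ) (B : List 𝒳 → Prop) (n : ℕ)
    (F G : List 𝒳 → ℝ) :
    stoppedExp str B n (fun l => F l + G l) =
      stoppedExp str B n F + stoppedExp str B n G := by
  classical
  have h : ∀ (E : List 𝒳 → Prop) k,
      horizonExp str k (fun l => if E l then F l + G l else 0) =
        horizonExp str k (fun l => if E l then F l else 0) +
          horizonExp str k (fun l => if E l then G l else 0) := fun E k => by
    rw [← horizonExp_add]
    congr 1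
    ext l
    split_ifs <;> simp
  simp only [stoppedExp, h, Finset.sum_add_distrib]
  ring

theorem stoppedExp_const_mul [Fintype 𝒳] (str : List 𝒳 → 𝒳 → ℝ) (B : List 𝒳 → Prop) (n : ℕ) (c : ℝ)
    (F : List 𝒳 → ℝ) :
    stoppedExp str B n (fun l => c * F l) = c * stoppedExp str B n F := by
  classical
  simp only [stoppedExp, mul_add, Finset.mul_sum, ← horizonExp_const_mul, mul_ite, mul_zero]

/-- Optional stopping: if the conditional increments of `W` are at most `d`, then
`E[W_{τ ∧ n}] ≤ W₀ + d E[τ ∧ n]`. -/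
theorem stoppedExp_le [Fintype 𝒳] {str : List 𝒳 → 𝒳 → ℝ} (hs : ∀ l, IsDist (str l))
    (B : List 𝒳 → Prop) {W : List 𝒳 → ℝ} {d : ℝ}
    (hW : ∀ l, ∑ y, str l y * W (l ++ [y]) ≤ W l + d) (n : ℕ) :
    stoppedExp str B n W ≤ W [] + d * ∑ k ∈ Finset.range n, probAt str k (notYet B) := by
  classical
  induction n with
  | zero =>
    have h : stopsAt B [] ↔ ¬ notYet B [] := by simp [stopsAt, notYet]
    by_cases hB : notYet B [] <;> simp [stoppedExp, horizonExp_zero, h, hB]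
  | succ n ih =>
    have h1 : horizonExp str (n + 1) (fun l => if stopsAt B l then W l else 0) +
        horizonExp str (n + 1) (fun l => if notYet B l then W l else 0) ≤
        horizonExp str n (fun l => if notYet B l then W l else 0) +
          d * probAt str n (notYet B) := by
      rw [← horizonExp_add, horizonExp_succ, probAt_eq_horizonExp, ← horizonExp_const_mul,
        ← horizonExp_add]
      refine horizonExp_mono hs n fun l => ?_
      have h2 : ∀ y, ((if stopsAt B (l ++ [y]) then W (l ++ [y]) else 0) +
          if notYet B (l ++ [y]) then W (l ++ [y]) else 0) =
          if notYet B l then W (l ++ [y]) else 0 := fun y => by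
        have h3 := stopsAt_or_notYet_append B l y
        by_cases h4 : stopsAt B (l ++ [y])
        · simp [h4, not_notYet_of_stopsAt h4, h3.1 (Or.inl h4)]
        · simp only [h4, false_or] at h3
          simp [h4, h3]
      simp only [h2]
      split_ifs with hl
      · simpa using hW l
      · simp
    unfold stoppedExp at ih ⊢
    rw [Finset.sum_range_succ _ (n + 1), Finset.sum_range_succ (fun k => probAt _ _ _), mul_add]
    linarith

theorem stoppedExp_one [Fintype 𝒳] {str : List 𝒳 → 𝒳 → ℝ} (hs : ∀ l, IsDist (str l))
    (B : List 𝒳 → Prop) (n : ℕ) : stoppedExp str B n (fun _ => 1) = 1 := by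
  refine le_antisymm ?_ ?_
  · simpa using stoppedExp_le hs B (W := fun _ => 1) (d := 0) (by simp [(hs _).2]) n
  · have h := stoppedExp_le hs B (W := fun _ => -1 * 1) (d := 0) (by simp [(hs _).2]) n
    rw [stoppedExp_const_mul] at h
    linarith

theorem tsum_list_eq [Fintype 𝒳] {f : List 𝒳 → ℝ} (hf : Summable f) :
    Summable (fun n => ∑ x : Fin n → 𝒳, f (List.ofFn x)) ∧
      ∑' l, f l = ∑' n, ∑ x : Fin n → 𝒳, f (List.ofFn x) := by
  have h := (List.equivSigmaTuple (α := 𝒳)).symm.summable_iff.2 hf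
  have h1 : (fun n => ∑' x : Fin n → 𝒳,
      (f ∘ List.equivSigmaTuple.symm) (⟨n, x⟩ : Σ n, Fin n → 𝒳)) =
      fun n => ∑ x : Fin n → 𝒳, f (List.ofFn x) := by
    ext n
    rw [tsum_fintype]
    rfl
  rw [← h1]
  exact ⟨h.sigma, by rw [← h.tsum_sigma]; exact (Equiv.tsum_eq _ f).symm⟩

theorem summable_list_of_sum_range_le [Fintype 𝒳] {f : List 𝒳 → ℝ} (hf : ∀ l, 0 ≤ f l) {c : ℝ}
    (h : ∀ n, ∑ k ∈ Finset.range n, ∑ x : Fin k → 𝒳, f (List.ofFn x) ≤ c) :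
    Summable f := by
  refine (List.equivSigmaTuple (α := 𝒳)).symm.summable_iff.1 ?_
  rw [summable_sigma_of_nonneg fun _ => by exact hf _]
  refine ⟨fun _ => Summable.of_finite, ?_⟩
  refine summable_of_sum_range_le (c := c) (fun n => tsum_nonneg fun _ => hf _) fun n => ?_
  simp only [tsum_fintype]
  exact h n

open Classical in
theorem sum_ofFn_errProb [Fintype 𝒳] (str : List 𝒳 → 𝒳 → ℝ) (B : List 𝒳 → Prop)
    (Z : List 𝒳 → Bool) (b : Bool) (n : ℕ) :
    ∑ x : Fin n → 𝒳, (if stopsAt B (List.ofFn x) ∧ Z (List.ofFn x) = b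
      then seqProb str (List.ofFn x) else 0) =
    horizonExp str n fun l => if stopsAt B l then (if Z l = b then 1 else 0) else 0 := by
  refine Finset.sum_congr rfl fun x _ => ?_
  by_cases h1 : stopsAt B (List.ofFn x) <;> by_cases h2 : Z (List.ofFn x) = b <;> simp [h1, h2]

open Classical in
theorem sum_range_le_stoppedExp [Fintype 𝒳] {str : List 𝒳 → 𝒳 → ℝ}
    (hs : ∀ l, IsDist (str l)) (B : List 𝒳 → Prop) (Z : List 𝒳 → Bool) (b : Bool)
    {F : List 𝒳 → ℝ} (hF : ∀ l, 0 ≤ F l) (hF1 : ∀ l, stopsAt B l → Z l = b → 1 ≤ F l)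
    {c : ℝ} (h : ∀ n, stoppedExp str B n F ≤ c) (n : ℕ) :
    ∑ k ∈ Finset.range n, horizonExp str k
      (fun l => if stopsAt B l then (if Z l = b then 1 else 0) else 0) ≤ c := by
  refine le_trans ?_ (h n)
  refine le_trans (Finset.sum_le_sum_of_subset_of_nonneg
    (Finset.range_subset_range.2 n.le_succ) fun k _ _ => horizonExp_nonneg hs k fun l => ?_) ?_
  · split_ifs <;> norm_num
  refine le_trans (Finset.sum_le_sum fun k _ => horizonExp_mono hs k fun l => ?_)
    (le_add_of_nonneg_right (horizonExp_nonneg hs n fun l => ?_))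
  · split_ifs with h1 h2
    exacts [hF1 l h1 h2, hF l, le_rfl]
  · split_ifs
    exacts [hF l, le_rfl]

theorem summable_errProb [Fintype 𝒳] {str : List 𝒳 → 𝒳 → ℝ} (hs : ∀ l, IsDist (str l))
    (B : List 𝒳 → Prop) (Z : List 𝒳 → Bool) (b : Bool) [∀ l, Decidable (stopsAt B l ∧ Z l = b)] :
    Summable fun l => if stopsAt B l ∧ Z l = b then seqProb str l else 0 := by
  classical
  refine summable_list_of_sum_range_le (c := 1) (fun l => ?_) fun n => ?_
  · split_ifs
    exacts [seqProb_nonneg hs l, le_rfl]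
  · convert sum_range_le_stoppedExp hs B Z b (F := fun _ => 1) (by simp) (by simp)
      (fun n => (stoppedExp_one hs B n).le) n using 2 with k
    rw [← sum_ofFn_errProb]
    congr!

open Classical in
theorem errProb_eq_tsum [Fintype 𝒳] {str : List 𝒳 → 𝒳 → ℝ} (hs : ∀ l, IsDist (str l))
    (B : List 𝒳 → Prop) (Z : List 𝒳 → Bool) (b : Bool) :
    Summable (fun k => horizonExp str k
      (fun l => if stopsAt B l then (if Z l = b then 1 else 0) else 0)) ∧
    errProb str B Z b = ∑' k, horizonExp str k
      (fun l => if stopsAt B l then (if Z l = b then 1 else 0) else 0) := by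
  have h := tsum_list_eq (summable_errProb hs B Z b)
  simp only [sum_ofFn_errProb] at h
  exact h

theorem errProb_le [Fintype 𝒳] {str : List 𝒳 → 𝒳 → ℝ}
    (hs : ∀ l, IsDist (str l)) (B : List 𝒳 → Prop) (Z : List 𝒳 → Bool) (b : Bool)
    {F : List 𝒳 → ℝ} (hF : ∀ l, 0 ≤ F l) (hF1 : ∀ l, stopsAt B l → Z l = b → 1 ≤ F l)
    {c : ℝ} (h : ∀ n, stoppedExp str B n F ≤ c) : errProb str B Z b ≤ c := by
  classical
  rw [(errProb_eq_tsum hs B Z b).2]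
  exact Real.tsum_le_of_sum_range_le
    (fun k => horizonExp_nonneg hs k fun l => by split_ifs <;> norm_num)
    (sum_range_le_stoppedExp hs B Z b hF hF1 h)

open Classical in
theorem sum_range_le_errProb [Fintype 𝒳] {str : List 𝒳 → 𝒳 → ℝ}
    (hs : ∀ l, IsDist (str l)) (B : List 𝒳 → Prop) (Z : List 𝒳 → Bool) (b : Bool) (n : ℕ) :
    ∑ k ∈ Finset.range n, horizonExp str k
      (fun l => if stopsAt B l then (if Z l = b then 1 else 0) else 0) ≤ errProb str B Z b := by
  rw [(errProb_eq_tsum hs B Z b).2]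
  exact (errProb_eq_tsum hs B Z b).1.sum_le_tsum _
    fun k _ => horizonExp_nonneg hs k fun l => by split_ifs <;> norm_num

theorem not_of_stopsAt_or_notYet_append {B : List 𝒳 → Prop} {l : List 𝒳} {y : 𝒳}
    (h : stopsAt B (l ++ [y]) ∨ notYet B (l ++ [y])) : ¬ B l := by
  simpa using (stopsAt_or_notYet_append B l y).1 h l.length le_rfl

theorem mul_exp_log_div {a b c : ℝ} (hb : 0 ≤ b) (hc : 0 ≤ c) (hab : b = 0 → a = 0)
    (hac : c = 0 → a = 0) : a * Real.exp (Real.log (b / c)) = a * (b / c) := by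
  by_cases ha : a = 0
  · simp [ha]
  · have hb' : 0 < b := lt_of_le_of_ne hb fun h => ha (hab h.symm)
    have hc' : 0 < c := lt_of_le_of_ne hc fun h => ha (hac h.symm)
    rw [Real.exp_log (by positivity)]

theorem KL_pos [Fintype 𝒳] {p q : 𝒳 → ℝ} (hp : IsDist p) (hq : IsDist q)
    (hpq : ∀ x, p x = 0 ↔ q x = 0) (hne : p ≠ q) : 0 < KL p q := by
  have h0 : ∑ x, (p x - q x) = 0 := by rw [Finset.sum_sub_distrib, hp.2, hq.2, sub_self]
  rw [← h0]
  obtain ⟨x₀, hx₀⟩ := Function.ne_iff.1 hne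
  have hlog : ∀ x, p x ≠ 0 → 0 < p x ∧ 0 < q x ∧
      p x * Real.log (p x / q x) = -(p x * Real.log (q x / p x)) ∧
      p x - q x = -(p x * (q x / p x - 1)) := fun x hx => by
    have h1 : 0 < p x := lt_of_le_of_ne (hp.1 x) (Ne.symm hx)
    have h2 : 0 < q x := lt_of_le_of_ne (hq.1 x) fun h => hx ((hpq x).2 h.symm)
    refine ⟨h1, h2, ?_, ?_⟩
    · rw [← inv_div, Real.log_inv, mul_neg]
    · field_simp
      ring
  refine Finset.sum_lt_sum (fun x _ => ?_) ⟨x₀, Finset.mem_univ _, ?_⟩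
  · by_cases hx : p x = 0
    · simp [hx, (hpq x).1 hx]
    · obtain ⟨h1, h2, h3, h4⟩ := hlog x hx
      rw [h3, h4]
      exact neg_le_neg (mul_le_mul_of_nonneg_left
        (Real.log_le_sub_one_of_pos (by positivity)) h1.le)
  · have hx : p x₀ ≠ 0 := fun h => hx₀ (h.trans ((hpq x₀).1 h).symm)
    obtain ⟨h1, h2, h3, h4⟩ := hlog x₀ hx
    rw [h3, h4]
    refine neg_lt_neg (mul_lt_mul_of_pos_left
      (Real.log_lt_sub_one_of_pos (by positivity) fun h => hx₀ ?_) h1)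
    rw [div_eq_one_iff_eq hx] at h
    exact h.symm

/-- First-order optimality of `p ↦ D(p‖q)` over a convex set. -/
theorem KL_le_sum_mul_log [Fintype 𝒳] {P : Set (𝒳 → ℝ)} (hP : ∀ p ∈ P, IsDist p)
    (hPconv : Convex ℝ P) {p q : 𝒳 → ℝ} (hp : p ∈ P) (hq : IsDist q)
    (hac : ∀ p ∈ P, ∀ x, p x = 0 ↔ q x = 0) (hmin : ∀ p' ∈ P, KL p q ≤ KL p' q)
    {p' : 𝒳 → ℝ} (hp' : p' ∈ P) : KL p q ≤ ∑ x, p' x * Real.log (p x / q x) := by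
  set A := ∑ x, p' x * Real.log (p x / q x)
  set K := ∑ x, (p' x - p x) ^ 2 / p x
  have key : ∀ ε ∈ Set.Ioo (0 : ℝ) 1, 0 ≤ (A - KL p q) + ε * K := fun ε ⟨h0, h1⟩ => by
    set r : 𝒳 → ℝ := (1 - ε) • p + ε • p'
    have hr : r ∈ P := hPconv hp hp' (by linarith) h0.le (by ring)
    have hrx : ∀ x, r x = p x + ε * (p' x - p x) := fun x => by
      simp only [r, Pi.add_apply, Pi.smul_apply, smul_eq_mul]
      ring
    have hterm : ∀ x, r x * Real.log (r x / q x) ≤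
        p x * Real.log (p x / q x) + ε * (p' x * Real.log (p x / q x)) -
          ε * (p x * Real.log (p x / q x)) + (r x - p x) + ε ^ 2 * ((p' x - p x) ^ 2 / p x) :=
      fun x => by
        by_cases hx : q x = 0
        · simp [hx, (hac _ hr x).2 hx, (hac _ hp x).2 hx, (hac _ hp' x).2 hx]
        · have hq0 : 0 < q x := lt_of_le_of_ne (hq.1 x) (Ne.symm hx)
          have hp0 : 0 < p x := lt_of_le_of_ne ((hP _ hp).1 x) fun h => hx ((hac _ hp x).1 h.symm)
          have hr0 : 0 < r x := lt_of_le_of_ne ((hP _ hr).1 x) fun h => hx ((hac _ hr x).1 h.symm)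
          have e1 : Real.log (r x / q x) = Real.log (p x / q x) + Real.log (r x / p x) := by
            rw [← Real.log_mul (by positivity) (by positivity)]
            congr 1
            field_simp
          have e2 : r x * Real.log (r x / p x) ≤ r x * (r x / p x - 1) :=
            mul_le_mul_of_nonneg_left (Real.log_le_sub_one_of_pos (by positivity)) hr0.le
          have e3 : r x * (r x / p x - 1) = (r x - p x) + ε ^ 2 * ((p' x - p x) ^ 2 / p x) := by
            rw [hrx]
            field_simp
            ring
          have e4 : r x * Real.log (p x / q x) = p x * Real.log (p x / q x) +
              ε * (p' x * Real.log (p x / q x)) - ε * (p x * Real.log (p x / q x)) := by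
            rw [hrx]
            ring
          rw [e1, mul_add]
          linarith
    have hsum := Finset.sum_le_sum fun x (_ : x ∈ Finset.univ) => hterm x
    simp only [Finset.sum_add_distrib, Finset.sum_sub_distrib, ← Finset.mul_sum,
      (hP _ hr).2, (hP _ hp).2] at hsum
    have hmin' := hmin r hr
    change KL r q ≤ KL p q + ε * A - ε * KL p q + (1 - 1) + ε ^ 2 * K at hsum
    have h2 : 0 ≤ ε * ((A - KL p q) + ε * K) := by nlinarith
    exact nonneg_of_mul_nonneg_right h2 h0
  have hlim : Filter.Tendsto (fun ε : ℝ => (A - KL p q) + ε * K) (nhdsWithin 0 (Set.Ioi 0))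
      (nhds ((A - KL p q) + 0 * K)) :=
    (Continuous.tendsto (by fun_prop) 0).mono_left nhdsWithin_le_nhds
  have := ge_of_tendsto hlim (Filter.eventually_of_mem (Ioo_mem_nhdsGT one_pos) key)
  linarith

/-- First-order optimality of `q ↦ D(p‖q)` over a convex set. -/
theorem sum_mul_div_le_one [Fintype 𝒳] {Q : Set (𝒳 → ℝ)} (hQ : ∀ q ∈ Q, IsDist q)
    (hQconv : Convex ℝ Q) {p q : 𝒳 → ℝ} (hp : IsDist p) (hq : q ∈ Q)
    (hac : ∀ q ∈ Q, ∀ x, p x = 0 ↔ q x = 0) (hmin : ∀ q' ∈ Q, KL p q ≤ KL p q')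
    {q' : 𝒳 → ℝ} (hq' : q' ∈ Q) : ∑ x, q' x * (p x / q x) ≤ 1 := by
  have key : ∀ ε ∈ Set.Ioo (0 : ℝ) 1,
      0 ≤ ∑ x, p x * ((q x - q' x) / (q x + ε * (q' x - q x))) := fun ε ⟨h0, h1⟩ => by
    set r : 𝒳 → ℝ := (1 - ε) • q + ε • q'
    have hr : r ∈ Q := hQconv hq hq' (by linarith) h0.le (by ring)
    have hrx : ∀ x, q x + ε * (q' x - q x) = r x := fun x => by
      simp only [r, Pi.add_apply, Pi.smul_apply, smul_eq_mul]
      ring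
    simp only [hrx]
    refine nonneg_of_mul_nonneg_right (a := ε) ?_ h0
    have hterm : ∀ x, p x * Real.log (p x / r x) - p x * Real.log (p x / q x) ≤
        ε * (p x * ((q x - q' x) / r x)) := fun x => by
      by_cases hx : p x = 0
      · simp [hx]
      · have hp0 : 0 < p x := lt_of_le_of_ne (hp.1 x) (Ne.symm hx)
        have hq0 : 0 < q x := lt_of_le_of_ne ((hQ _ hq).1 x) fun h => hx ((hac _ hq x).2 h.symm)
        have hr0 : 0 < r x := lt_of_le_of_ne ((hQ _ hr).1 x) fun h => hx ((hac _ hr x).2 h.symm)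
        have e1 : Real.log (p x / r x) = Real.log (p x / q x) + Real.log (q x / r x) := by
          rw [← Real.log_mul (by positivity) (by positivity)]
          congr 1
          field_simp
        have e2 : p x * Real.log (q x / r x) ≤ p x * (q x / r x - 1) :=
          mul_le_mul_of_nonneg_left (Real.log_le_sub_one_of_pos (by positivity)) hp0.le
        have e3 : p x * (q x / r x - 1) = ε * (p x * ((q x - q' x) / r x)) := by
          have e4 : q x - r x = ε * (q x - q' x) := by rw [← hrx]; ring
          rw [div_sub_one hr0.ne', e4]
          ring
        rw [e1, mul_add]
        linarith
    have hsum := Finset.sum_le_sum fun x (_ : x ∈ Finset.univ) => hterm x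
    simp only [Finset.sum_sub_distrib, ← Finset.mul_sum] at hsum
    have hmin' := hmin r hr
    unfold KL at hmin'
    linarith
  have hlim : Filter.Tendsto
      (fun ε : ℝ => ∑ x, p x * ((q x - q' x) / (q x + ε * (q' x - q x))))
      (nhdsWithin 0 (Set.Ioi 0))
      (nhds (∑ x, p x * ((q x - q' x) / (q x + 0 * (q' x - q x))))) := by
    refine Filter.Tendsto.mono_left (tendsto_finsetSum _ fun x _ => ?_) nhdsWithin_le_nhds
    by_cases hx : p x = 0
    · simp [hx]
    · have hq0 : q x + 0 * (q' x - q x) ≠ 0 := by simpa using mt (hac _ hq x).2 hx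
      exact tendsto_const_nhds.mul (tendsto_const_nhds.div
        (Continuous.tendsto (by fun_prop) 0) hq0)
  have h := ge_of_tendsto hlim (Filter.eventually_of_mem (Ioo_mem_nhdsGT one_pos) key)
  have h2 : ∀ x, p x * ((q x - q' x) / (q x + 0 * (q' x - q x))) =
      p x - q' x * (p x / q x) := fun x => by
    by_cases hx : p x = 0
    · simp [hx]
    · have hq0 := mt (hac _ hq x).2 hx
      rw [zero_mul, add_zero]
      field_simp
  simp only [h2, Finset.sum_sub_distrib, hp.2] at h
  linarith

/-- Ville-type bound: stopping with decision `b` only when the log-likelihood ratio exceeds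
`-log β` has probability at most `β` if the likelihood ratio is a supermartingale. -/
theorem errProb_le_of_llSum [Fintype 𝒳] {str : List 𝒳 → 𝒳 → ℝ}
    (hs : ∀ l, IsDist (str l)) {p q : 𝒳 → ℝ}
    (hstep : ∀ l, ∑ y, str l y * Real.exp (Real.log (p y / q y)) ≤ 1)
    {B : List 𝒳 → Prop} {Z : List 𝒳 → Bool} {b : Bool} {β : ℝ} (hβ : 0 < β)
    (h : ∀ l, B l → Z l = b → -Real.log β ≤ llSum p q l) : errProb str B Z b ≤ β := by
  refine errProb_le hs B Z b (F := fun l => β * Real.exp (llSum p q l))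
    (fun l => by positivity) (fun l hl hb => ?_) fun n => ?_
  · have h1 := Real.exp_le_exp.2 (h l hl.1 hb)
    rw [Real.exp_neg, Real.exp_log hβ] at h1
    calc (1 : ℝ) = β * β⁻¹ := (mul_inv_cancel₀ hβ.ne').symm
      _ ≤ _ := mul_le_mul_of_nonneg_left h1 hβ.le
  · refine (stoppedExp_le hs B (d := 0) (fun l => ?_) n).trans (by simp [llSum_nil])
    have h1 : ∀ y, str l y * (β * Real.exp (llSum p q (l ++ [y]))) =
        β * Real.exp (llSum p q l) * (str l y * Real.exp (Real.log (p y / q y))) := fun y => by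
      rw [llSum_append_singleton, Real.exp_add]
      ring
    simp only [h1, ← Finset.mul_sum, add_zero]
    exact mul_le_of_le_one_right (by positivity) (hstep l)

/-- Wald-type bound on the expected time for the log-likelihood ratio to exceed `c`. -/
theorem expTau_le_of_llSum [Fintype 𝒳] {str : List 𝒳 → 𝒳 → ℝ}
    (hs : ∀ l, IsDist (str l)) {p q : 𝒳 → ℝ} {D C c : ℝ} (hD : 0 < D) (hcC : 0 ≤ c + C)
    (hC : ∀ y, Real.log (p y / q y) ≤ C)
    (hstep : ∀ l, D ≤ ∑ y, str l y * Real.log (p y / q y))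
    {B : List 𝒳 → Prop} (hB : ∀ l, c ≤ llSum p q l → B l) :
    expTau str B ≤ ENNReal.ofReal ((c + C) / D) := by
  refine ENNReal.tsum_le_of_sum_range_le fun n => ?_
  rw [← ENNReal.ofReal_sum_of_nonneg fun k _ => probAt_nonneg hs k _]
  refine ENNReal.ofReal_le_ofReal ?_
  have h1 := stoppedExp_le hs B (W := fun l => (c + C) - llSum p q l) (d := -D) (fun l => by
    have h2 : ∀ y, str l y * ((c + C) - llSum p q (l ++ [y])) =
        str l y * ((c + C) - llSum p q l) - str l y * Real.log (p y / q y) := fun y => by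
      rw [llSum_append_singleton]
      ring
    simp only [h2, Finset.sum_sub_distrib, ← Finset.sum_mul, (hs l).2]
    linarith [hstep l]) n
  have h3 : 0 * stoppedExp str B n (fun _ => 1) ≤
      stoppedExp str B n fun l => (c + C) - llSum p q l := by
    rw [← stoppedExp_const_mul]
    refine stoppedExp_mono hs B n fun l hl => ?_
    rcases List.eq_nil_or_concat' l with rfl | ⟨l, y, rfl⟩
    · simpa [llSum_nil] using hcC
    · have h4 := not_of_stopsAt_or_notYet_append hl
      have h5 : llSum p q l < c := lt_of_not_ge fun h => h4 (hB l h)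
      rw [llSum_append_singleton]
      linarith [hC y]
  rw [llSum_nil] at h1
  rw [le_div_iff₀ hD]
  linarith

theorem one_le_expTau [Fintype 𝒳] (str : List 𝒳 → 𝒳 → ℝ) {B : List 𝒳 → Prop}
    (hB : ¬ B []) : 1 ≤ expTau str B := by
  classical
  have h : probAt str 0 (notYet B) = 1 := by
    rw [probAt_eq_horizonExp, horizonExp_zero, if_pos]
    simpa [notYet] using hB
  have h1 := ENNReal.le_tsum (f := fun n => ENNReal.ofReal (probAt str n (notYet B))) 0
  simpa [expTau, h] using h1

theorem seqProb_const_mul_exp [Fintype 𝒳] {p q : 𝒳 → ℝ} (hp : IsDist p) (hq : IsDist q)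
    (hpq : ∀ x, p x = 0 ↔ q x = 0) (l : List 𝒳) :
    seqProb (fun _ => p) l * Real.exp (-llSum p q l) = seqProb (fun _ => q) l := by
  induction l using List.reverseRecOn with
  | nil => simp [seqProb_nil, llSum_nil]
  | append_singleton l y ih =>
    rw [seqProb_append_singleton, seqProb_append_singleton, llSum_append_singleton, neg_add,
      Real.exp_add, mul_mul_mul_comm, ih, ← Real.log_inv, inv_div,
      mul_exp_log_div (hq.1 y) (hp.1 y) (hpq y).2 id]
    congr 1
    by_cases hy : p y = 0
    · simp [hy, (hpq y).1 hy]
    · field_simp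

theorem stoppedExp_const_mul_exp [Fintype 𝒳] {p q : 𝒳 → ℝ} (hp : IsDist p) (hq : IsDist q)
    (hpq : ∀ x, p x = 0 ↔ q x = 0) (B : List 𝒳 → Prop) (n : ℕ) (F : List 𝒳 → ℝ) :
    stoppedExp (fun _ => p) B n (fun l => F l * Real.exp (-llSum p q l)) =
      stoppedExp (fun _ => q) B n F := by
  classical
  simp only [stoppedExp, horizonExp, ← seqProb_const_mul_exp hp hq hpq, mul_ite, mul_zero,
    mul_assoc, mul_comm (F _)]

/-- Change of measure: both error probabilities at most `β` force the expected stopping time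
under `p` to be about `-log β / D(p‖q)`. -/
theorem neg_log_mul_le [Fintype 𝒳] {p q : 𝒳 → ℝ} (hp : IsDist p) (hq : IsDist q)
    (hpq : ∀ x, p x = 0 ↔ q x = 0) (hD : 0 ≤ KL p q) {B : List 𝒳 → Prop} {Z : List 𝒳 → Bool}
    {b : Bool} {β : ℝ} (hβ : 0 < β) (hβ1 : β < 1)
    (herr : errProb (fun _ => p) B Z b ≤ β) (herr' : errProb (fun _ => q) B Z (!b) ≤ β)
    (hT : expTau (fun _ => p) B ≠ ⊤) :
    -Real.log β * (1 - β) ≤ KL p q * (expTau (fun _ => p) B).toReal + 1 := by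
  classical
  have hs : ∀ _ : List 𝒳, IsDist p := fun _ => hp
  have hs' : ∀ _ : List 𝒳, IsDist q := fun _ => hq
  set L := -Real.log β
  have hL : 0 < L := by simpa [L] using Real.log_neg hβ hβ1
  set a : ℕ → ℝ := fun n => probAt (fun _ => p) n (notYet B)
  have ha : ∀ n, 0 ≤ a n := fun n => probAt_nonneg hs n _
  have hsum : Summable a := by
    have := ENNReal.summable_toReal hT
    exact this.congr fun n => ENNReal.toReal_ofReal (ha n)
  have hTa : (expTau (fun _ => p) B).toReal = ∑' n, a n := by
    rw [expTau, ← ENNReal.ofReal_tsum_of_nonneg ha hsum, ENNReal.toReal_ofReal (tsum_nonneg ha)]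
  let I : List 𝒳 → ℝ := fun l => if stopsAt B l ∧ Z l = !b then 1 else 0
  have hIs : ∀ (str : List 𝒳 → 𝒳 → ℝ) n, stoppedExp str B n I =
      ∑ k ∈ Finset.range (n + 1), horizonExp str k
        (fun l => if stopsAt B l then (if Z l = !b then 1 else 0) else 0) := fun str n => by
    have h1 : ∀ l, (if stopsAt B l then I l else 0) =
        if stopsAt B l then (if Z l = !b then 1 else 0) else 0 := fun l => by
      by_cases h : stopsAt B l <;> simp [I, h]
    have h2 : ∀ l, (if notYet B l then I l else 0) = 0 := fun l => by
      by_cases h : stopsAt B l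
      · simp [not_notYet_of_stopsAt h]
      · simp [I, h]
    simp only [stoppedExp, h1, h2]
    simp [horizonExp]
  have hIq : ∀ n, stoppedExp (fun _ => q) B n I ≤ β := fun n => by
    rw [hIs]
    exact (sum_range_le_errProb hs' B Z _ _).trans herr'
  have hIp : ∀ n, 1 - β - a n ≤ stoppedExp (fun _ => p) B n I := fun n => by
    have h1 := stoppedExp_one hs B n
    have h2 := sum_range_le_errProb hs B Z b (n + 1)
    have h3 : ∀ l, (if stopsAt B l then (1 : ℝ) else 0) =
        (if stopsAt B l then (if Z l = b then 1 else 0) else 0) +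
          (if stopsAt B l then (if Z l = !b then 1 else 0) else 0) := fun l => by
      cases b <;> cases Z l <;> simp
    rw [hIs]
    simp only [stoppedExp, h3, horizonExp_add, Finset.sum_add_distrib,
      ← probAt_eq_horizonExp] at h1
    change _ + a n = 1 at h1
    linarith
  have hS : ∀ n, stoppedExp (fun _ => p) B n (llSum p q) ≤ KL p q * ∑' n, a n := fun n => by
    refine (stoppedExp_le hs B (d := KL p q) (fun l => ?_) n).trans ?_
    · simp only [llSum_append_singleton, mul_add, Finset.sum_add_distrib, ← Finset.sum_mul, hp.2,
        one_mul]
      exact le_rfl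
    · rw [llSum_nil, zero_add]
      exact mul_le_mul_of_nonneg_left (hsum.sum_le_tsum _ fun k _ => ha k) hD
  have key : ∀ n, L * (1 - β - a n) ≤ KL p q * ∑' n, a n + 1 := fun n => by
    have h1 : stoppedExp (fun _ => p) B n (fun l => L * I l) ≤
        stoppedExp (fun _ => p) B n (fun l => (llSum p q l +
          (β⁻¹ * I l + 1) * Real.exp (-llSum p q l)) + -1 * 1) := by
      refine stoppedExp_mono hs B n fun l _ => ?_
      have h2 : L * I l ≤ Real.log (β⁻¹ * I l + 1) := by
        by_cases h : stopsAt B l ∧ Z l = !b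
        · simp only [I, h, L, and_self, if_true, mul_one, ← Real.log_inv]
          exact Real.log_le_log (by positivity) (by linarith)
        · simp [I, h]
      have h3 : 0 < β⁻¹ * I l + 1 := by
        have : 0 ≤ I l := by simp only [I]; split_ifs <;> norm_num
        positivity
      have h4 := Real.log_le_sub_one_of_pos (mul_pos h3 (Real.exp_pos (-llSum p q l)))
      rw [Real.log_mul h3.ne' (Real.exp_pos _).ne', Real.log_exp] at h4
      linarith
    rw [stoppedExp_const_mul, stoppedExp_add, stoppedExp_add, stoppedExp_const_mul,
      stoppedExp_const_mul_exp hp hq hpq, stoppedExp_add, stoppedExp_const_mul,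
      stoppedExp_one hs, stoppedExp_one hs'] at h1
    have h5 := mul_le_mul_of_nonneg_left (hIp n) hL.le
    have h6 := mul_le_mul_of_nonneg_left (hIq n) (inv_nonneg.2 hβ.le)
    rw [inv_mul_cancel₀ hβ.ne'] at h6
    linarith [hS n]
  have hlim : Filter.Tendsto (fun n => L * (1 - β - a n)) Filter.atTop
      (nhds (L * (1 - β - 0))) :=
    tendsto_const_nhds.mul (tendsto_const_nhds.sub hsum.tendsto_atTop_zero)
  rw [sub_zero] at hlim
  rw [hTa]
  exact le_of_tendsto' hlim key

theorem tendsto_neg_log_nhdsGT_zero :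
    Filter.Tendsto (fun β : ℝ => -Real.log β) (nhdsWithin 0 (Set.Ioi 0)) Filter.atTop :=
  Filter.tendsto_neg_atBot_atTop.comp Real.tendsto_log_nhdsGT_zero

theorem tendsto_upper_bound (D : ℝ) :
    Filter.Tendsto (fun β : ℝ => D / ((1 - β) - (-Real.log β)⁻¹))
      (nhdsWithin 0 (Set.Ioi 0)) (nhds D) := by
  have h1 : Filter.Tendsto (fun β : ℝ => 1 - β) (nhdsWithin 0 (Set.Ioi 0)) (nhds (1 - 0)) :=
    (Continuous.tendsto (by fun_prop) 0).mono_left nhdsWithin_le_nhds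
  have h2 := (tendsto_const_nhds (x := D)).div
    (h1.sub tendsto_neg_log_nhdsGT_zero.inv_tendsto_atTop) (by norm_num)
  rwa [sub_zero, sub_zero, div_one] at h2

theorem tendsto_lower_bound (D C : ℝ) :
    Filter.Tendsto (fun β : ℝ => D / (1 + C * (-Real.log β)⁻¹))
      (nhdsWithin 0 (Set.Ioi 0)) (nhds D) := by
  have h2 := (tendsto_const_nhds (x := D)).div ((tendsto_const_nhds (x := (1 : ℝ))).add
    ((tendsto_const_nhds (x := C)).mul tendsto_neg_log_nhdsGT_zero.inv_tendsto_atTop))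
    (by norm_num)
  rwa [mul_zero, add_zero, div_one] at h2

/-- Worst-case exponent of a family of stopping regions against strategies in `P`. -/
noncomputable def worstExponent [Fintype 𝒳] (P : Set (𝒳 → ℝ)) (B : ℝ → List 𝒳 → Prop)
    (β : ℝ) : ℝ :=
  ⨅ str : {s : List 𝒳 → 𝒳 → ℝ // IsStrategy P s},
    -Real.log β / (expTau str.1 (B β)).toReal

theorem eventually_worstExponent_le [Fintype 𝒳] {P : Set (𝒳 → ℝ)} {p q : 𝒳 → ℝ}
    (hpP : p ∈ P) (hp : IsDist p) (hq : IsDist q) (hpq : ∀ x, p x = 0 ↔ q x = 0)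
    (hD : 0 ≤ KL p q) {B : ℝ → List 𝒳 → Prop} {Z : ℝ → List 𝒳 → Bool} {b : Bool}
    (herr : ∀ β, 0 < β → errProb (fun _ => p) (B β) (Z β) b ≤ β)
    (herr' : ∀ β, 0 < β → errProb (fun _ => q) (B β) (Z β) (!b) ≤ β) :
    ∀ᶠ β in nhdsWithin 0 (Set.Ioi 0), 0 ≤ worstExponent P B β ∧
      worstExponent P B β ≤ KL p q / ((1 - β) - (-Real.log β)⁻¹) := by
  filter_upwards [Ioo_mem_nhdsGT (show (0 : ℝ) < 1 / 2 by norm_num),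
    tendsto_neg_log_nhdsGT_zero.eventually_gt_atTop 2] with β ⟨h0, h1⟩ hL
  set L := -Real.log β
  have hnn : ∀ str : {s : List 𝒳 → 𝒳 → ℝ // IsStrategy P s},
      0 ≤ L / (expTau str.1 (B β)).toReal := fun str =>
    div_nonneg (by linarith) ENNReal.toReal_nonneg
  have hLi : L⁻¹ < 1 / 2 := by
    rw [inv_lt_comm₀ (by linarith) (by norm_num)]
    linarith
  have hpos : 0 < (1 - β) - L⁻¹ := by linarith
  refine ⟨Real.iInf_nonneg hnn, ?_⟩
  refine (ciInf_le ⟨0, by rintro _ ⟨str, rfl⟩; exact hnn str⟩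
    (⟨fun _ => p, fun _ => hpP⟩ : {s : List 𝒳 → 𝒳 → ℝ // IsStrategy P s})).trans ?_
  change L / (expTau (fun _ => p) (B β)).toReal ≤ _
  by_cases hT : expTau (fun _ => p) (B β) = ⊤
  · rw [hT]
    simpa using div_nonneg hD hpos.le
  have h := neg_log_mul_le hp hq hpq hD h0 (by linarith) (herr β h0) (herr' β h0) hT
  change L * (1 - β) ≤ _ at h
  rcases (ENNReal.toReal_nonneg (a := expTau (fun _ => p) (B β))).eq_or_lt with h2 | h2
  · rw [← h2]
    simpa using div_nonneg hD hpos.le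
  · rw [div_le_div_iff₀ h2 hpos, mul_sub, mul_inv_cancel₀ (by linarith)]
    linarith

theorem liminf_worstExponent_le [Fintype 𝒳] {P : Set (𝒳 → ℝ)} {p q : 𝒳 → ℝ}
    (hpP : p ∈ P) (hp : IsDist p) (hq : IsDist q) (hpq : ∀ x, p x = 0 ↔ q x = 0)
    (hD : 0 ≤ KL p q) {B : ℝ → List 𝒳 → Prop} {Z : ℝ → List 𝒳 → Bool} {b : Bool}
    (herr : ∀ β, 0 < β → errProb (fun _ => p) (B β) (Z β) b ≤ β)
    (herr' : ∀ β, 0 < β → errProb (fun _ => q) (B β) (Z β) (!b) ≤ β) :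
    Filter.liminf (worstExponent P B) (nhdsWithin 0 (Set.Ioi 0)) ≤ KL p q := by
  have h := eventually_worstExponent_le hpP hp hq hpq hD herr herr'
  have hu := tendsto_upper_bound (KL p q)
  rw [← hu.liminf_eq]
  exact Filter.liminf_le_liminf (h.mono fun _ h => h.2)
    (Filter.isBoundedUnder_of_eventually_ge (h.mono fun _ h => h.1))
    hu.isBoundedUnder_le.isCoboundedUnder_ge

theorem le_liminf_worstExponent [Fintype 𝒳] {P : Set (𝒳 → ℝ)} (hP : ∀ p ∈ P, IsDist p)
    {p q : 𝒳 → ℝ} (hpP : p ∈ P) (hq : IsDist q) (hpq : ∀ x, p x = 0 ↔ q x = 0)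
    (hD : 0 < KL p q) {B : ℝ → List 𝒳 → Prop} {Z : ℝ → List 𝒳 → Bool} {b : Bool}
    (herr : ∀ β, 0 < β → errProb (fun _ => p) (B β) (Z β) b ≤ β)
    (herr' : ∀ β, 0 < β → errProb (fun _ => q) (B β) (Z β) (!b) ≤ β)
    (hstep : ∀ p' ∈ P, KL p q ≤ ∑ y, p' y * Real.log (p y / q y))
    (hB : ∀ β l, -Real.log β ≤ llSum p q l → B β l) (hB0 : ∀ β, 0 < -Real.log β → ¬ B β []) :
    KL p q ≤ Filter.liminf (worstExponent P B) (nhdsWithin 0 (Set.Ioi 0)) := by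
  have h := eventually_worstExponent_le hpP (hP p hpP) hq hpq hD.le herr herr'
  set C := ∑ y, |Real.log (p y / q y)|
  have hC : ∀ y, Real.log (p y / q y) ≤ C := fun y => (le_abs_self _).trans
    (Finset.single_le_sum (f := fun y => |Real.log (p y / q y)|) (fun _ _ => abs_nonneg _)
      (Finset.mem_univ y))
  have hC0 : 0 ≤ C := Finset.sum_nonneg fun _ _ => abs_nonneg _
  have hlow : ∀ᶠ β in nhdsWithin 0 (Set.Ioi 0),
      KL p q / (1 + C * (-Real.log β)⁻¹) ≤ worstExponent P B β := by
    filter_upwards [tendsto_neg_log_nhdsGT_zero.eventually_gt_atTop 0] with β hL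
    have : Nonempty {s : List 𝒳 → 𝒳 → ℝ // IsStrategy P s} := ⟨⟨fun _ => p, fun _ => hpP⟩⟩
    refine le_ciInf fun str => ?_
    have hT := expTau_le_of_llSum (fun l => hP _ (str.2 l)) hD (by linarith) hC
      (fun l => hstep _ (str.2 l)) (hB β)
    have hT1 := one_le_expTau str.1 (hB0 β hL)
    have hTr := ENNReal.toReal_mono ENNReal.ofReal_ne_top hT
    rw [ENNReal.toReal_ofReal (by positivity), le_div_iff₀ hD] at hTr
    have hTr1 : 1 ≤ (expTau str.1 (B β)).toReal := by
      simpa using ENNReal.toReal_mono (ne_top_of_le_ne_top ENNReal.ofReal_ne_top hT) hT1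
    rw [div_le_div_iff₀ (by positivity) (by linarith), mul_add, mul_left_comm,
      mul_inv_cancel₀ hL.ne']
    linarith
  exact (tendsto_of_tendsto_of_tendsto_of_le_of_le' (tendsto_lower_bound (KL p q) C)
    (tendsto_upper_bound (KL p q)) hlow (h.mono fun _ h => h.2)).liminf_eq.ge

/-- **Theorem 3.** Under the constraint that both worst-case error
probabilities are at most `β`, the closure of the set of achievable pairs of exponents is
exactly `{(Ẽ₀,Ẽ₁) : Ẽ₀ ≤ D(p₀*‖q₀*), Ẽ₁ ≤ D(q₁*‖p₁*)}`; in particular the corner point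
`(D(p₀*‖q₀*), D(q₁*‖p₁*))` is achievable. -/
theorem stmt17 [Fintype 𝒳] [Nonempty 𝒳]
    (P Q : Set (𝒳 → ℝ))
    (hP : ∀ p ∈ P, IsDist p) (hQ : ∀ q ∈ Q, IsDist q)
    (hPclosed : IsClosed P) (hQclosed : IsClosed Q)
    (hPconv : Convex ℝ P) (hQconv : Convex ℝ Q)
    (hdisj : Disjoint P Q)
    (hac : ∀ p ∈ P, ∀ q ∈ Q, ∀ x, (p x = 0 ↔ q x = 0))
    (p₀ q₀ : 𝒳 → ℝ) (hp₀ : p₀ ∈ P) (hq₀ : q₀ ∈ Q)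
    (hmin₀ : ∀ p ∈ P, ∀ q ∈ Q, KL p₀ q₀ ≤ KL p q)
    (p₁ q₁ : 𝒳 → ℝ) (hp₁ : p₁ ∈ P) (hq₁ : q₁ ∈ Q)
    (hmin₁ : ∀ p ∈ P, ∀ q ∈ Q, KL q₁ p₁ ≤ KL q p)
    :
    closure {e : ℝ × ℝ | AchievableTilde P Q e.1 e.2} =
      {e : ℝ × ℝ | e.1 ≤ KL p₀ q₀ ∧ e.2 ≤ KL q₁ p₁} ∧
    AchievableTilde P Q (KL p₀ q₀) (KL q₁ p₁) := by
  have hac' : ∀ p ∈ P, ∀ q ∈ Q, ∀ x, (q x = 0 ↔ p x = 0) := fun p hp q hq x =>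
    (hac p hp q hq x).symm
  have hD₀ : 0 < KL p₀ q₀ := KL_pos (hP _ hp₀) (hQ _ hq₀) (hac _ hp₀ _ hq₀)
    (hdisj.ne_of_mem hp₀ hq₀)
  have hD₁ : 0 < KL q₁ p₁ := KL_pos (hQ _ hq₁) (hP _ hp₁) (hac' _ hp₁ _ hq₁)
    (hdisj.ne_of_mem hp₁ hq₁).symm
  have hcorner : AchievableTilde P Q (KL p₀ q₀) (KL q₁ p₁) := by
    classical
    let B : ℝ → List 𝒳 → Prop := fun β l =>
      -Real.log β ≤ llSum p₀ q₀ l ∨ -Real.log β ≤ llSum q₁ p₁ l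
    let Z : ℝ → List 𝒳 → Bool := fun β l => decide (-Real.log β ≤ llSum q₁ p₁ l)
    have herrP : ∀ β : ℝ, 0 < β → ∀ str : List 𝒳 → 𝒳 → ℝ, IsStrategy P str →
        errProb str (B β) (Z β) true ≤ β := fun β hβ str hstr => by
      refine errProb_le_of_llSum (fun l => hP _ (hstr l)) (fun l => ?_) hβ
        (p := q₁) (q := p₁) fun l _ hZ => by simpa [Z] using hZ
      have h := sum_mul_div_le_one hP hPconv (hQ _ hq₁) hp₁ (fun p hp => hac' p hp _ hq₁)
        (fun p hp => hmin₁ p hp q₁ hq₁) (hstr l)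
      refine le_of_eq_of_le (Finset.sum_congr rfl fun y _ => ?_) h
      exact mul_exp_log_div ((hQ _ hq₁).1 y) ((hP _ hp₁).1 y) (hac _ (hstr l) _ hq₁ y).2
        fun h => (hac _ (hstr l) _ hq₁ y).2 ((hac _ hp₁ _ hq₁ y).1 h)
    have herrQ : ∀ β : ℝ, 0 < β → ∀ str : List 𝒳 → 𝒳 → ℝ, IsStrategy Q str →
        errProb str (B β) (Z β) false ≤ β := fun β hβ str hstr => by
      refine errProb_le_of_llSum (fun l => hQ _ (hstr l)) (fun l => ?_) hβ
        (p := p₀) (q := q₀) fun l hl hZ => hl.resolve_right (by simpa [Z] using hZ)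
      have h := sum_mul_div_le_one hQ hQconv (hP _ hp₀) hq₀ (fun q hq => hac _ hp₀ q hq)
        (fun q hq => hmin₀ p₀ hp₀ q hq) (hstr l)
      refine le_of_eq_of_le (Finset.sum_congr rfl fun y _ => ?_) h
      exact mul_exp_log_div ((hP _ hp₀).1 y) ((hQ _ hq₀).1 y) (hac _ hp₀ _ (hstr l) y).1
        fun h => (hac _ hp₀ _ (hstr l) y).1 ((hac _ hp₀ _ hq₀ y).2 h)
    have hB0 : ∀ β, 0 < -Real.log β → ¬ B β [] := fun β hβ => by
      simp only [B, llSum_nil, or_self]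
      exact not_le.2 hβ
    refine ⟨B, Z, fun β hβ => ⟨herrP β hβ, herrQ β hβ⟩, ?_, ?_⟩
    · exact le_liminf_worstExponent (b := true) hP hp₀ (hQ _ hq₀) (hac _ hp₀ _ hq₀) hD₀
        (fun β hβ => herrP β hβ _ fun _ => hp₀) (fun β hβ => herrQ β hβ _ fun _ => hq₀)
        (fun p hp => KL_le_sum_mul_log hP hPconv hp₀ (hQ _ hq₀)
          (fun p hp => hac p hp _ hq₀) (fun p hp => hmin₀ p hp q₀ hq₀) hp)
        (fun β l => Or.inl) hB0
    · exact le_liminf_worstExponent (b := false) hQ hq₁ (hP _ hp₁) (hac' _ hp₁ _ hq₁) hD₁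
        (fun β hβ => herrQ β hβ _ fun _ => hq₁) (fun β hβ => herrP β hβ _ fun _ => hp₁)
        (fun q hq => KL_le_sum_mul_log hQ hQconv hq₁ (hP _ hp₁)
          (fun q hq => hac' _ hp₁ q hq) (fun q hq => hmin₁ p₁ hp₁ q hq) hq)
        (fun β l => Or.inr) hB0
  refine ⟨Set.Subset.antisymm (closure_minimal ?_ ?_) ?_, hcorner⟩
  · rintro ⟨E₀, E₁⟩ ⟨B, Z, herr, h₀, h₁⟩
    exact ⟨h₀.trans (liminf_worstExponent_le (b := true) hp₀ (hP _ hp₀) (hQ _ hq₀)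
        (hac _ hp₀ _ hq₀) hD₀.le (fun β hβ => (herr β hβ).1 _ fun _ => hp₀)
        fun β hβ => (herr β hβ).2 _ fun _ => hq₀),
      h₁.trans (liminf_worstExponent_le (b := false) hq₁ (hQ _ hq₁) (hP _ hp₁)
        (hac' _ hp₁ _ hq₁) hD₁.le (fun β hβ => (herr β hβ).2 _ fun _ => hq₁)
        fun β hβ => (herr β hβ).1 _ fun _ => hp₁)⟩
  · exact (isClosed_le continuous_fst continuous_const).inter
      (isClosed_le continuous_snd continuous_const)
  · rintro ⟨E₀, E₁⟩ ⟨h₀, h₁⟩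
    obtain ⟨B, Z, herr, h₀', h₁'⟩ := hcorner
    exact subset_closure ⟨B, Z, herr, h₀.trans h₀', h₁.trans h₁'⟩
end

section
/- (Appendix Lemma) For every q ∈ 𝒬, Σ_{x∈𝒳} q(x)·(p_H*(x)/q_H*(x))^{1−λ*} ≤ Σ_{x∈𝒳} q_H*(x)·(p_H*(x)/q_H*(x))^{1−λ*} = 2^{ψ_{λ*}(p_H*‖q_H*)}, and for every p ∈ 𝒫, Σ_{x∈𝒳} p(x)·(q_H*(x)/p_H*(x))^{λ*} ≤ Σ_{x∈𝒳} p_H*(x)·(q_H*(x)/p_H*(x))^{λ*} = 2^{ψ_{λ*}(p_H*‖q_H*)}. -/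
open scoped BigOperators ENNReal

variable {𝒳 : Type*}

/-- `ψ_λ(p‖q) = log₂ ∑ₓ p(x)^{1−λ} q(x)^{λ}`. -/
noncomputable def psiFn [Fintype 𝒳] (lam : ℝ) (p q : 𝒳 → ℝ) : ℝ :=
  Real.logb 2 (∑ x, p x ^ (1 - lam) * q x ^ lam)

/-- The Hoeffding-type objective `(−λr − ψ_λ(p‖q))/(1−λ)`. -/
noncomputable def hoeffObj [Fintype 𝒳] (r lam : ℝ) (p q : 𝒳 → ℝ) : ℝ :=
  (-(lam * r) - psiFn lam p q) / (1 - lam)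

lemma mul_div_rpow_one_sub {p q : ℝ} (hp : 0 < p) (hq : 0 < q) (l : ℝ) :
    q * (p / q) ^ (1 - l) = p ^ (1 - l) * q ^ l := by
  rw [Real.div_rpow hp.le hq.le, Real.rpow_sub hq, Real.rpow_one]
  have := (Real.rpow_pos_of_pos hq l).ne'
  field_simp

lemma mul_div_rpow {p q : ℝ} (hp : 0 < p) (hq : 0 < q) (l : ℝ) :
    p * (q / p) ^ l = p ^ (1 - l) * q ^ l := by
  rw [Real.div_rpow hq.le hp.le, Real.rpow_sub hp, Real.rpow_one]
  ring

/-- The tangent-plane bound at `(p, q)` for the concave function `(a, b) ↦ a ^ (1 - l) * b ^ l`. -/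
lemma rpow_mul_rpow_le_tangent {p q a b l : ℝ} (hp : 0 < p) (hq : 0 < q) (ha : 0 ≤ a)
    (hb : 0 ≤ b) (hl : l ∈ Set.Icc (0 : ℝ) 1) :
    a ^ (1 - l) * b ^ l ≤ (1 - l) * (a * (q / p) ^ l) + l * (b * (p / q) ^ (1 - l)) := by
  have hA : 0 ≤ (q / p) ^ l := by positivity
  have hB : 0 ≤ (p / q) ^ (1 - l) := by positivity
  have key := Real.geom_mean_le_arith_mean2_weighted (sub_nonneg.2 hl.2) hl.1
    (mul_nonneg ha hA) (mul_nonneg hb hB) (by ring)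
  refine le_trans (le_of_eq ?_) key
  have hcancel : ((q / p) ^ l) ^ (1 - l) * ((p / q) ^ (1 - l)) ^ l = 1 := by
    rw [← Real.rpow_mul (by positivity), ← Real.rpow_mul (by positivity), mul_comm (1 - l) l,
      ← Real.mul_rpow (by positivity) (by positivity)]
    have : q / p * (p / q) = 1 := by field_simp
    rw [this, Real.one_rpow]
  rw [Real.mul_rpow ha hA, Real.mul_rpow hb hB]
  linear_combination (-(a ^ (1 - l) * b ^ l)) * hcancel

lemma zero_rpow_one_sub_mul_zero_rpow (l : ℝ) : (0 : ℝ) ^ (1 - l) * (0 : ℝ) ^ l = 0 := by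
  rcases eq_or_ne l 0 with rfl | h
  · simp
  · simp [Real.zero_rpow h]

section Pair

variable [Fintype 𝒳] {p q a b : 𝒳 → ℝ}

/-- The pointwise dichotomy for equivalent distributions. -/
lemma IsDist.both_zero_or_pos (hp : IsDist p) (hq : IsDist q) (h : ∀ x, p x = 0 ↔ q x = 0)
    (x : 𝒳) : (p x = 0 ∧ q x = 0) ∨ (0 < p x ∧ 0 < q x) := by
  by_cases h0 : p x = 0
  · exact Or.inl ⟨h0, (h x).1 h0⟩
  · exact Or.inr ⟨(hp.1 x).lt_of_ne' h0, (hq.1 x).lt_of_ne' fun h1 => h0 ((h x).2 h1)⟩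

lemma sum_rpow_mul_rpow_pos (hp : IsDist p) (hq : IsDist q) (h : ∀ x, p x = 0 ↔ q x = 0)
    (l : ℝ) : 0 < ∑ x, p x ^ (1 - l) * q x ^ l := by
  obtain ⟨x, hx⟩ : ∃ x, p x ≠ 0 := by
    by_contra! hall
    have := hp.2
    simp [hall] at this
  refine Finset.sum_pos' (fun y _ => mul_nonneg (Real.rpow_nonneg (hp.1 y) _)
    (Real.rpow_nonneg (hq.1 y) _)) ⟨x, Finset.mem_univ x, ?_⟩
  rcases hp.both_zero_or_pos hq h x with h0 | ⟨h1, h2⟩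
  · exact absurd h0.1 hx
  · positivity

lemma sum_mul_div_rpow_one_sub (hp : IsDist p) (hq : IsDist q) (h : ∀ x, p x = 0 ↔ q x = 0)
    (l : ℝ) : ∑ x, q x * (p x / q x) ^ (1 - l) = (2 : ℝ) ^ psiFn l p q := by
  rw [psiFn, Real.rpow_logb two_pos (by norm_num) (sum_rpow_mul_rpow_pos hp hq h l)]
  refine Finset.sum_congr rfl fun x _ => ?_
  rcases hp.both_zero_or_pos hq h x with ⟨h1, h2⟩ | ⟨h1, h2⟩
  · rw [h1, h2, zero_rpow_one_sub_mul_zero_rpow, zero_mul]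
  · exact mul_div_rpow_one_sub h1 h2 l

lemma sum_mul_div_rpow (hp : IsDist p) (hq : IsDist q) (h : ∀ x, p x = 0 ↔ q x = 0)
    (l : ℝ) : ∑ x, p x * (q x / p x) ^ l = (2 : ℝ) ^ psiFn l p q := by
  rw [psiFn, Real.rpow_logb two_pos (by norm_num) (sum_rpow_mul_rpow_pos hp hq h l)]
  refine Finset.sum_congr rfl fun x _ => ?_
  rcases hp.both_zero_or_pos hq h x with ⟨h1, h2⟩ | ⟨h1, h2⟩
  · rw [h1, h2, zero_rpow_one_sub_mul_zero_rpow, zero_mul]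
  · exact mul_div_rpow h1 h2 l

lemma psiFn_zero (hp : IsDist p) : psiFn 0 p q = 0 := by
  simp [psiFn, hp.2]

lemma psiFn_one (hq : IsDist q) : psiFn 1 p q = 0 := by
  simp [psiFn, hq.2]

/-- If moving from `(p, q)` to `(p + t (a - p), q + t (b - q))` does not increase the sum, then the
directional derivative at the end point is nonpositive. -/
lemma directional_deriv_nonpos {t l : ℝ} (ht : 0 < t) (hl : l ∈ Set.Icc (0 : ℝ) 1)
    (hp : ∀ x, 0 ≤ p x) (hq : ∀ x, 0 ≤ q x)
    (hx : ∀ x, (p x = 0 ∧ q x = 0 ∧ a x = 0 ∧ b x = 0) ∨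
      (0 < p x + t * (a x - p x) ∧ 0 < q x + t * (b x - q x)))
    (hle : ∑ x, (p x + t * (a x - p x)) ^ (1 - l) * (q x + t * (b x - q x)) ^ l ≤
      ∑ x, p x ^ (1 - l) * q x ^ l) :
    ∑ x, ((1 - l) * ((a x - p x) * ((q x + t * (b x - q x)) / (p x + t * (a x - p x))) ^ l) +
      l * ((b x - q x) * ((p x + t * (a x - p x)) / (q x + t * (b x - q x))) ^ (1 - l))) ≤ 0 := by
  have key : ∑ x, p x ^ (1 - l) * q x ^ l ≤
      ∑ x, ((p x + t * (a x - p x)) ^ (1 - l) * (q x + t * (b x - q x)) ^ l -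
      t * ((1 - l) * ((a x - p x) * ((q x + t * (b x - q x)) / (p x + t * (a x - p x))) ^ l) +
      l * ((b x - q x) *
        ((p x + t * (a x - p x)) / (q x + t * (b x - q x))) ^ (1 - l)))) := by
    refine Finset.sum_le_sum fun x _ => ?_
    rcases hx x with ⟨h1, h2, h3, h4⟩ | ⟨h1, h2⟩
    · simp [h1, h2, h3, h4, zero_rpow_one_sub_mul_zero_rpow]
    · have e1 := mul_div_rpow h1 h2 l
      have e2 := mul_div_rpow_one_sub h1 h2 l
      have e3 := rpow_mul_rpow_le_tangent h1 h2 (hp x) (hq x) hl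
      linear_combination e3 + (1 - l) * e1 + l * e2
  rw [Finset.sum_sub_distrib, ← Finset.mul_sum] at key
  by_contra! hpos
  linarith [mul_pos ht hpos]

end Pair

section FirstOrder

variable [Fintype 𝒳] {P Q : Set (𝒳 → ℝ)}

/-- If the Hoeffding exponent of `(p, q)` is at least `M > 0`, then the objective, cleared of its
denominator, reaches `M` somewhere on `[0, 1]`. -/
lemma exists_mem_Icc_le_zero {p q : 𝒳 → ℝ} {r M : ℝ} (hM : 0 < M)
    (hcont : ContinuousOn (fun l => l * r + psiFn l p q + M * (1 - l)) (Set.Icc 0 1))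
    (hsup : M ≤ sSup ((fun l => hoeffObj r l p q) '' Set.Icc (0 : ℝ) 1)) :
    ∃ l ∈ Set.Icc (0 : ℝ) 1, l * r + psiFn l p q + M * (1 - l) ≤ 0 := by
  obtain ⟨l₀, hl₀, hmin⟩ := isCompact_Icc.exists_isMinOn (Set.nonempty_Icc.2 zero_le_one) hcont
  refine ⟨l₀, hl₀, ?_⟩
  by_contra! hc
  set c := l₀ * r + psiFn l₀ p q + M * (1 - l₀)
  have hbound : sSup ((fun l => hoeffObj r l p q) '' Set.Icc (0 : ℝ) 1) ≤ max (M - c) 0 := by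
    refine csSup_le ((Set.nonempty_Icc.2 zero_le_one).image _) ?_
    rintro _ ⟨l, hl, rfl⟩
    rcases hl.2.eq_or_lt with rfl | hlt
    · simp [hoeffObj]
    · refine le_max_of_le_left ?_
      have h1 : c ≤ l * r + psiFn l p q + M * (1 - l) := hmin hl
      show hoeffObj r l p q ≤ M - c
      rw [hoeffObj, div_le_iff₀ (sub_pos.2 hlt)]
      nlinarith [mul_nonneg hc.le hl.1]
  have : max (M - c) 0 < M := max_lt (by linarith) hM
  linarith

/-- The first-order optimality condition at the minimizer, in the joint direction of
`(p, q) ∈ P × Q`. -/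
lemma first_order_condition
    (hP : ∀ p ∈ P, IsDist p) (hQ : ∀ q ∈ Q, IsDist q)
    (hPconv : Convex ℝ P) (hQconv : Convex ℝ Q)
    (hac : ∀ p ∈ P, ∀ q ∈ Q, ∀ x, (p x = 0 ↔ q x = 0))
    {r : ℝ} (hr : 0 < r) {pH qH : 𝒳 → ℝ} (hpH : pH ∈ P) (hqH : qH ∈ Q)
    (hminH : ∀ p ∈ P, ∀ q ∈ Q,
      sSup ((fun lam => hoeffObj r lam pH qH) '' Set.Icc (0 : ℝ) 1) ≤
        sSup ((fun lam => hoeffObj r lam p q) '' Set.Icc (0 : ℝ) 1))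
    {s : ℝ} (hs : s ∈ Set.Ioo (0 : ℝ) 1)
    (hmax : ∀ lam ∈ Set.Icc (0 : ℝ) 1, hoeffObj r lam pH qH ≤ hoeffObj r s pH qH)
    (huniq : ∀ lam ∈ Set.Icc (0 : ℝ) 1,
      hoeffObj r lam pH qH = hoeffObj r s pH qH → lam = s)
    {p q : 𝒳 → ℝ} (hp : p ∈ P) (hq : q ∈ Q) :
    ∑ x, ((1 - s) * ((p x - pH x) * (qH x / pH x) ^ s) +
      s * ((q x - qH x) * (pH x / qH x) ^ (1 - s))) ≤ 0 := by
  set M := hoeffObj r s pH qH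
  have hs' : s ∈ Set.Icc (0 : ℝ) 1 := ⟨hs.1.le, hs.2.le⟩
  have hM : 0 < M := by
    have h0 : hoeffObj r 0 pH qH = 0 := by simp [hoeffObj, psiFn_zero (hP _ hpH)]
    have hmem : (0 : ℝ) ∈ Set.Icc (0 : ℝ) 1 := by simp
    refine (h0 ▸ hmax 0 hmem).lt_of_ne fun he => hs.1.ne (huniq 0 hmem (h0.trans he))
  have hMle : ∀ p ∈ P, ∀ q ∈ Q,
      M ≤ sSup ((fun lam => hoeffObj r lam p q) '' Set.Icc (0 : ℝ) 1) := fun p hp q hq =>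
    (le_csSup ⟨M, by rintro _ ⟨l, hl, rfl⟩; exact hmax l hl⟩
      (Set.mem_image_of_mem (fun lam => hoeffObj r lam pH qH) hs')).trans
      (hminH p hp q hq)
  have hnonneg : ∀ l ∈ Set.Icc (0 : ℝ) 1, 0 ≤ l * r + psiFn l pH qH + M * (1 - l) := by
    intro l hl
    rcases hl.2.eq_or_lt with rfl | hlt
    · rw [psiFn_one (hQ _ hqH)]; linarith
    · have := hmax l hl
      rw [hoeffObj, div_le_iff₀ (sub_pos.2 hlt)] at this
      linarith
  have hzero : ∀ l ∈ Set.Icc (0 : ℝ) 1, l * r + psiFn l pH qH + M * (1 - l) ≤ 0 → l = s := by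
    intro l hl h
    rcases hl.2.eq_or_lt with rfl | hlt
    · rw [psiFn_one (hQ _ hqH)] at h; linarith
    · refine huniq l hl (le_antisymm (hmax l hl) ?_)
      rw [hoeffObj, le_div_iff₀ (sub_pos.2 hlt)]
      linarith
  let u : ℝ → 𝒳 → ℝ := fun t x => pH x + t * (p x - pH x)
  let v : ℝ → 𝒳 → ℝ := fun t x => qH x + t * (q x - qH x)
  have hu : ∀ t ∈ Set.Icc (0 : ℝ) 1, u t ∈ P := fun t ht => hPconv.add_smul_sub_mem hpH hp ht
  have hv : ∀ t ∈ Set.Icc (0 : ℝ) 1, v t ∈ Q := fun t ht => hQconv.add_smul_sub_mem hqH hq ht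
  have hu0 : u 0 = pH := by ext x; simp [u]
  have hv0 : v 0 = qH := by ext x; simp [v]
  have hcase : ∀ x, (pH x = 0 ∧ qH x = 0 ∧ p x = 0 ∧ q x = 0) ∨
      ∀ t ∈ Set.Icc (0 : ℝ) 1, 0 < u t x ∧ 0 < v t x := by
    intro x
    by_cases h0 : pH x = 0
    · have h1 := (hac _ hpH _ hqH x).1 h0
      exact Or.inl ⟨h0, h1, (hac _ hp _ hqH x).2 h1, (hac _ hpH _ hq x).1 h0⟩
    · refine Or.inr fun t ht => ?_
      have h1 : qH x ≠ 0 := fun h => h0 ((hac _ hpH _ hqH x).2 h)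
      have h2 : u t x ≠ 0 := fun h => h1 ((hac _ (hu t ht) _ hqH x).1 h)
      have h3 : v t x ≠ 0 := fun h => h0 ((hac _ hpH _ (hv t ht) x).2 h)
      exact ⟨((hP _ (hu t ht)).1 x).lt_of_ne' h2, ((hQ _ (hv t ht)).1 x).lt_of_ne' h3⟩
  let K : Set (ℝ × ℝ) := Set.Icc 0 1 ×ˢ Set.Icc 0 1
  have hucont : ∀ x, ContinuousOn (fun z : ℝ × ℝ => u z.2 x) K := fun x => by fun_prop
  have hvcont : ∀ x, ContinuousOn (fun z : ℝ × ℝ => v z.2 x) K := fun x => by fun_prop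
  have hpsi : ContinuousOn (fun z : ℝ × ℝ => psiFn z.1 (u z.2) (v z.2)) K := by
    have hG : ContinuousOn
        (fun z : ℝ × ℝ => ∑ x, u z.2 x ^ (1 - z.1) * v z.2 x ^ z.1) K := by
      refine continuousOn_finsetSum _ fun x _ => ?_
      rcases hcase x with ⟨h1, h2, h3, h4⟩ | h
      · simpa [u, v, h1, h2, h3, h4, zero_rpow_one_sub_mul_zero_rpow]
          using continuousOn_const
      · exact ((hucont x).rpow (by fun_prop) fun z hz => Or.inl (h z.2 hz.2).1.ne').mul
          ((hvcont x).rpow (by fun_prop) fun z hz => Or.inl (h z.2 hz.2).2.ne')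
    refine (hG.log fun z hz => ?_).div_const _
    exact (sum_rpow_mul_rpow_pos (hP _ (hu _ hz.2)) (hQ _ (hv _ hz.2))
      (hac _ (hu _ hz.2) _ (hv _ hz.2)) _).ne'
  have hF : ContinuousOn
      (fun z : ℝ × ℝ => z.1 * r + psiFn z.1 (u z.2) (v z.2) + M * (1 - z.1)) K := by
    exact (((by fun_prop : ContinuousOn (fun z : ℝ × ℝ => z.1 * r) K).add hpsi).add (by fun_prop))
  have hE : ContinuousOn (fun z : ℝ × ℝ =>
      ∑ x, ((1 - z.1) * ((p x - pH x) * (v z.2 x / u z.2 x) ^ z.1) +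
        z.1 * ((q x - qH x) * (u z.2 x / v z.2 x) ^ (1 - z.1)))) K := by
    refine continuousOn_finsetSum _ fun x _ => ?_
    rcases hcase x with ⟨h1, h2, h3, h4⟩ | h
    · simpa [h1, h2, h3, h4] using continuousOn_const
    · have hvu := (hvcont x).div (hucont x) fun z hz => (h z.2 hz.2).1.ne'
      have huv := (hucont x).div (hvcont x) fun z hz => (h z.2 hz.2).2.ne'
      have h1 := hvu.rpow (by fun_prop : ContinuousOn (fun z : ℝ × ℝ => z.1) K)
        fun z hz => Or.inl (div_pos (h z.2 hz.2).2 (h z.2 hz.2).1).ne'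
      have h2 := huv.rpow (by fun_prop : ContinuousOn (fun z : ℝ × ℝ => 1 - z.1) K)
        fun z hz => Or.inl (div_pos (h z.2 hz.2).1 (h z.2 hz.2).2).ne'
      exact ((by fun_prop : ContinuousOn (fun z : ℝ × ℝ => 1 - z.1) K).mul
        (continuousOn_const.mul h1)).add
        ((by fun_prop : ContinuousOn (fun z : ℝ × ℝ => z.1) K).mul (continuousOn_const.mul h2))
  have htmem : ∀ n : ℕ, (1 / ((n : ℝ) + 1)) ∈ Set.Icc (0 : ℝ) 1 := fun n =>
    ⟨by positivity, by rw [div_le_one (by positivity)]; linarith [(n.cast_nonneg : (0 : ℝ) ≤ n)]⟩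
  have hex : ∀ n : ℕ, ∃ l ∈ Set.Icc (0 : ℝ) 1,
      l * r + psiFn l (u (1 / ((n : ℝ) + 1))) (v (1 / ((n : ℝ) + 1))) + M * (1 - l) ≤ 0 := by
    intro n
    refine exists_mem_Icc_le_zero hM ?_ (hMle _ (hu _ (htmem n)) _ (hv _ (htmem n)))
    exact hF.comp (by fun_prop : ContinuousOn (fun l : ℝ => (l, 1 / ((n : ℝ) + 1))) (Set.Icc 0 1))
      fun l hl => ⟨hl, htmem n⟩
  choose l hl hle using hex
  obtain ⟨l', hl', φ, hφ, hlim⟩ := isCompact_Icc.tendsto_subseq hl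
  have hzlim : Filter.Tendsto (fun n => (l (φ n), 1 / ((φ n : ℝ) + 1))) Filter.atTop
      (nhdsWithin (l', 0) K) := by
    refine tendsto_nhdsWithin_iff.2 ⟨hlim.prodMk_nhds ?_, .of_forall fun n => ⟨hl _, htmem _⟩⟩
    exact tendsto_one_div_add_atTop_nhds_zero_nat.comp hφ.tendsto_atTop
  have hmem : (l', (0 : ℝ)) ∈ K := ⟨hl', by simp⟩
  have hls : l' = s := by
    refine hzero l' hl' ?_
    have := le_of_tendsto ((hF _ hmem).tendsto.comp hzlim) (.of_forall fun n => hle (φ n))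
    simpa [hu0, hv0] using this
  have hlimE := le_of_tendsto ((hE _ hmem).tendsto.comp hzlim) (b := 0) (.of_forall fun n => ?_)
  · simpa [hu0, hv0, hls] using hlimE
  · have ht := htmem (φ n)
    refine directional_deriv_nonpos (by positivity) (hl _) (hP _ hpH).1 (hQ _ hqH).1
      (fun x => (hcase x).imp_right fun h => h _ ht) ?_
    have h1 := hle (φ n)
    have h2 := hnonneg _ (hl (φ n))
    have h3 : psiFn (l (φ n)) (u (1 / ((φ n : ℝ) + 1))) (v (1 / ((φ n : ℝ) + 1))) ≤
      psiFn (l (φ n)) pH qH := by linarith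
    exact (Real.logb_le_logb one_lt_two
      (sum_rpow_mul_rpow_pos (hP _ (hu _ ht)) (hQ _ (hv _ ht)) (hac _ (hu _ ht) _ (hv _ ht)) _)
      (sum_rpow_mul_rpow_pos (hP _ hpH) (hQ _ hqH) (hac _ hpH _ hqH) _)).1 h3

end FirstOrder

/-- **Appendix lemma.** Let `(p_H*, q_H*)` minimize
`sup_{0≤λ≤1} (−λr − ψ_λ(p‖q))/(1−λ)` over `𝒫 × 𝒬` and let `λ* ∈ (0,1)` be the unique
maximizer of `λ ↦ (−λr − ψ_λ(p_H*‖q_H*))/(1−λ)` on `[0,1]`.  Then for every `q ∈ 𝒬`,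
`∑ₓ q(x)(p_H*(x)/q_H*(x))^{1−λ*} ≤ ∑ₓ q_H*(x)(p_H*(x)/q_H*(x))^{1−λ*} = 2^{ψ_{λ*}(p_H*‖q_H*)}`,
and for every `p ∈ 𝒫`,
`∑ₓ p(x)(q_H*(x)/p_H*(x))^{λ*} ≤ ∑ₓ p_H*(x)(q_H*(x)/p_H*(x))^{λ*} = 2^{ψ_{λ*}(p_H*‖q_H*)}`. -/
theorem stmt19 [Fintype 𝒳] [Nonempty 𝒳]
    (P Q : Set (𝒳 → ℝ))
    (hP : ∀ p ∈ P, IsDist p) (hQ : ∀ q ∈ Q, IsDist q)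
    (hPclosed : IsClosed P) (hQclosed : IsClosed Q)
    (hPconv : Convex ℝ P) (hQconv : Convex ℝ Q)
    (hdisj : Disjoint P Q)
    (hac : ∀ p ∈ P, ∀ q ∈ Q, ∀ x, (p x = 0 ↔ q x = 0))
    (r : ℝ) (hr : 0 < r)
    (pH qH : 𝒳 → ℝ) (hpH : pH ∈ P) (hqH : qH ∈ Q)
    (hminH : ∀ p ∈ P, ∀ q ∈ Q,
      sSup ((fun lam => hoeffObj r lam pH qH) '' Set.Icc (0 : ℝ) 1) ≤
        sSup ((fun lam => hoeffObj r lam p q) '' Set.Icc (0 : ℝ) 1))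
    (lamStar : ℝ) (hlam : lamStar ∈ Set.Ioo (0 : ℝ) 1)
    (hmax : ∀ lam ∈ Set.Icc (0 : ℝ) 1, hoeffObj r lam pH qH ≤ hoeffObj r lamStar pH qH)
    (huniq : ∀ lam ∈ Set.Icc (0 : ℝ) 1,
      hoeffObj r lam pH qH = hoeffObj r lamStar pH qH → lam = lamStar) :
    (∀ q ∈ Q, ∑ x, q x * (pH x / qH x) ^ (1 - lamStar) ≤
        ∑ x, qH x * (pH x / qH x) ^ (1 - lamStar)) ∧
    (∑ x, qH x * (pH x / qH x) ^ (1 - lamStar) = (2 : ℝ) ^ psiFn lamStar pH qH) ∧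
    (∀ p ∈ P, ∑ x, p x * (qH x / pH x) ^ lamStar ≤
        ∑ x, pH x * (qH x / pH x) ^ lamStar) ∧
    (∑ x, pH x * (qH x / pH x) ^ lamStar = (2 : ℝ) ^ psiFn lamStar pH qH) := by
  have hfoc := @first_order_condition 𝒳 _ P Q hP hQ hPconv hQconv hac r hr pH qH hpH hqH hminH
    lamStar hlam hmax huniq
  refine ⟨fun q hq => ?_, sum_mul_div_rpow_one_sub (hP _ hpH) (hQ _ hqH) (hac _ hpH _ hqH) _,
    fun p hp => ?_, sum_mul_div_rpow (hP _ hpH) (hQ _ hqH) (hac _ hpH _ hqH) _⟩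
  · have h := hfoc hpH hq
    simp only [sub_self, zero_mul, mul_zero, zero_add, ← Finset.mul_sum, sub_mul,
      Finset.sum_sub_distrib] at h
    exact sub_nonpos.1 (nonpos_of_mul_nonpos_right h hlam.1)
  · have h := hfoc hp hqH
    simp only [sub_self, zero_mul, mul_zero, add_zero, ← Finset.mul_sum, sub_mul (p _),
      Finset.sum_sub_distrib] at h
    exact sub_nonpos.1 (nonpos_of_mul_nonpos_right h (sub_pos.2 hlam.2))
end
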